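/- Let p : ℕ → ℝ with 0 < p(n) < 1 for all n. If n·p(n)·(1 − p(n)) − 2·log n → ∞ as n → ∞, then asymptotically almost surely a random graph Γ ∈ G(n, p(n)) contains no ordered pair of distinct vertices (v, w) with lk(v) ⊆ st(w). In particular this holds for any constant p with 0 < p < 1. -/

import Mathlib

open Finset Filter Topology

attribute [local instance] Classical.propDecidable

/-- The Erdős–Rényi weight of a graph `Γ` on `n` vertices with edge probability `p`:
`p^{E_Γ} (1-p)^{C(n,2) - E_Γ}`. -/
noncomputable def gnpWeight (n : ℕ) (p : ℝ) (Γ : SimpleGraph (Fin n)) : ℝ :=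
  p ^ Γ.edgeSet.ncard * (1 - p) ^ (n.choose 2 - Γ.edgeSet.ncard)

/-- The probability of the event `A` under the Erdős–Rényi model `G(n,p)`. -/
noncomputable def gnpProb (n : ℕ) (p : ℝ) (A : SimpleGraph (Fin n) → Prop) : ℝ :=
  ∑ Γ : SimpleGraph (Fin n), if A Γ then gnpWeight n p Γ else 0

/-- The expectation of a random variable `X` under the Erdős–Rényi model `G(n,p)`. -/
noncomputable def gnpExp (n : ℕ) (p : ℝ) (X : SimpleGraph (Fin n) → ℝ) : ℝ :=
  ∑ Γ : SimpleGraph (Fin n), gnpWeight n p Γ * X Γ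

/-- `lk(v) ⊆ st(w)`: every vertex adjacent to `v` either equals `w` or is adjacent to `w`. -/
def LinkSubsetStar {V : Type*} (Γ : SimpleGraph V) (v w : V) : Prop :=
  ∀ u : V, Γ.Adj v u → (u = w ∨ Γ.Adj w u)

/-- In a binomial random subset `S` of `E`, the probability that `f u ∈ S → g u ∈ S` for all
`u ∈ U`, where the elements `f u`, `g u` are pairwise distinct. -/
theorem sum_powerset_forall_imp {α β : Type*} (p : ℝ) (f g : β → α) (U : Finset β)
    (E : Finset α) (hfE : ∀ u ∈ U, f u ∈ E) (hgE : ∀ u ∈ U, g u ∈ E)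
    (hf : ∀ u ∈ U, ∀ u' ∈ U, f u = f u' → u = u') (hg : ∀ u ∈ U, ∀ u' ∈ U, g u = g u' → u = u')
    (hfg : ∀ u ∈ U, ∀ u' ∈ U, f u ≠ g u') :
    ∑ S ∈ E.powerset, (if ∀ u ∈ U, f u ∈ S → g u ∈ S then
      p ^ #S * (1 - p) ^ (#E - #S) else 0) = (1 - p * (1 - p)) ^ #U := by
  induction U using Finset.induction_on generalizing E with
  | empty => simp [Finset.sum_pow_mul_eq_add_pow]
  | insert a U ha ih =>
    have haU : a ∈ insert a U := mem_insert_self a U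
    have hU : ∀ u ∈ U, u ∈ insert a U := fun u hu => mem_insert_of_mem hu
    have hne : ∀ u ∈ U, u ≠ a := fun u hu h => ha (h ▸ hu)
    obtain ⟨E', hfE', hgE', rfl⟩ : ∃ E', f a ∉ insert (g a) E' ∧ g a ∉ E' ∧
        E = insert (f a) (insert (g a) E') := by
      have hga : g a ∈ E.erase (f a) := mem_erase.2 ⟨(hfg a haU a haU).symm, hgE a haU⟩
      refine ⟨(E.erase (f a)).erase (g a), ?_, notMem_erase _ _, ?_⟩
      · rw [insert_erase hga]
        exact notMem_erase _ _
      · rw [insert_erase hga, insert_erase (hfE a haU)]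
    have hff : ∀ u ∈ U, f u ≠ f a := fun u hu h => hne u hu (hf u (hU u hu) a haU h)
    have hgg : ∀ u ∈ U, g u ≠ g a := fun u hu h => hne u hu (hg u (hU u hu) a haU h)
    have hfga : ∀ u ∈ U, f u ≠ g a := fun u hu => hfg u (hU u hu) a haU
    have hgfa : ∀ u ∈ U, g u ≠ f a := fun u hu => (hfg a haU u (hU u hu)).symm
    have key := ih E'
      (fun u hu => by simpa [hff u hu, hfga u hu] using hfE u (hU u hu))
      (fun u hu => by simpa [hgg u hu, hgfa u hu] using hgE u (hU u hu))
      (fun u hu u' hu' => hf u (hU u hu) u' (hU u' hu'))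
      (fun u hu u' hu' => hg u (hU u hu) u' (hU u' hu'))
      (fun u hu u' hu' => hfg u (hU u hu) u' (hU u' hu'))
    rw [sum_powerset_insert hfE', sum_powerset_insert hgE', sum_powerset_insert hgE',
      ← sum_add_distrib, ← sum_add_distrib, ← sum_add_distrib, card_insert_of_notMem ha, pow_succ,
      ← key, sum_mul]
    refine sum_congr rfl fun S hS => ?_
    rw [mem_powerset] at hS
    have hgS : g a ∉ S := fun h => hgE' (hS h)
    have hfS' : f a ∉ insert (g a) S := fun h => hfE' (insert_subset_insert _ hS h)
    have hfS : f a ∉ S := fun h => hfS' (mem_insert_of_mem h)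
    have h1 : (∀ u ∈ insert a U, f u ∈ S → g u ∈ S) ↔ ∀ u ∈ U, f u ∈ S → g u ∈ S := by
      rw [forall_mem_insert]
      simp [hfS]
    have h2 : (∀ u ∈ insert a U, f u ∈ insert (g a) S → g u ∈ insert (g a) S) ↔
        ∀ u ∈ U, f u ∈ S → g u ∈ S := by
      rw [forall_mem_insert]
      simp +contextual [hgg, hfga]
    have h3 : ¬ ∀ u ∈ insert a U, f u ∈ insert (f a) S → g u ∈ insert (f a) S := by
      intro h
      have := h a haU (mem_insert_self _ _)
      simp [hgS, (hfg a haU a haU).symm] at this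
    have h4 : (∀ u ∈ insert a U, f u ∈ insert (f a) (insert (g a) S) →
        g u ∈ insert (f a) (insert (g a) S)) ↔ ∀ u ∈ U, f u ∈ S → g u ∈ S := by
      rw [forall_mem_insert]
      simp +contextual [hgg, hfga, hff, hgfa]
    simp only [h1, h2, h3, h4, if_false, card_insert_of_notMem hfE', card_insert_of_notMem hgE',
      card_insert_of_notMem hfS', card_insert_of_notMem hgS]
    have hc : #S ≤ #E' := card_le_card hS
    obtain ⟨k, hk⟩ := Nat.exists_eq_add_of_le hc
    have e1 : #E' + 1 + 1 - #S = k + 2 := by lia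
    have e2 : #E' + 1 + 1 - (#S + 1) = k + 1 := by lia
    have e3 : #E' + 1 + 1 - (#S + 1 + 1) = k := by lia
    have e4 : #E' - #S = k := by lia
    rw [e1, e2, e3, e4]
    split_ifs
    · ring
    · simp

/-- Sums over graphs against the Erdős–Rényi weight are sums over sets of edges. -/
theorem gnpProb_eq_sum_powerset (n : ℕ) (p : ℝ) (A : SimpleGraph (Fin n) → Prop)
    (B : Finset (Sym2 (Fin n)) → Prop) (hAB : ∀ Γ, A Γ ↔ B Γ.edgeFinset) :
    gnpProb n p A = ∑ S ∈ (⊤ : SimpleGraph (Fin n)).edgeFinset.powerset, (if B S then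
      p ^ #S * (1 - p) ^ (#(⊤ : SimpleGraph (Fin n)).edgeFinset - #S) else 0) := by
  unfold gnpProb gnpWeight
  refine sum_bij (fun Γ _ => Γ.edgeFinset) (fun Γ _ => ?_) (fun Γ _ Γ' _ h => ?_)
    (fun S hS => ?_) (fun Γ _ => ?_)
  · rw [mem_powerset, SimpleGraph.edgeFinset_subset_edgeFinset]
    exact le_top
  · exact SimpleGraph.edgeFinset_inj.1 h
  · refine ⟨SimpleGraph.fromEdgeSet (S : Set (Sym2 (Fin n))), mem_univ _, ?_⟩
    ext e
    rw [mem_powerset] at hS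
    have hmem (Γ : SimpleGraph (Fin n)) : e ∈ Γ.edgeFinset ↔ e ∈ Γ.edgeSet :=
      SimpleGraph.mem_edgeFinset
    rw [hmem, SimpleGraph.edgeSet_fromEdgeSet]
    refine ⟨fun h => h.1, fun h => ⟨h, ?_⟩⟩
    have := SimpleGraph.mem_edgeFinset.1 (hS h)
    exact SimpleGraph.not_isDiag_of_mem_edgeSet _ this
  · rw [SimpleGraph.card_edgeFinset_top_eq_card_choose_two, Fintype.card_fin,
      ← SimpleGraph.coe_edgeFinset, Set.ncard_coe_finset]
    simp only [hAB]

theorem gnpProb_true (n : ℕ) (p : ℝ) : gnpProb n p (fun _ => True) = 1 := by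
  rw [gnpProb_eq_sum_powerset n p _ (fun _ => True) (fun _ => Iff.rfl)]
  simp [Finset.sum_pow_mul_eq_add_pow]

theorem gnpProb_linkSubsetStar (n : ℕ) (p : ℝ) {v w : Fin n} (hvw : v ≠ w) :
    gnpProb n p (fun Γ => LinkSubsetStar Γ v w) = (1 - p * (1 - p)) ^ (n - 2) := by
  have hcard : #((univ.erase v).erase w) = n - 2 := by
    rw [card_erase_of_mem (by simp [hvw.symm]), card_erase_of_mem (mem_univ v), card_univ,
      Fintype.card_fin]
    lia
  rw [← hcard, ← sum_powerset_forall_imp p (fun u => s(v, u)) (fun u => s(w, u))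
    ((univ.erase v).erase w) (⊤ : SimpleGraph (Fin n)).edgeFinset]
  · convert gnpProb_eq_sum_powerset n p _
      (fun S => ∀ u ∈ (univ.erase v).erase w, s(v, u) ∈ S → s(w, u) ∈ S) fun Γ => ?_
    simp only [LinkSubsetStar, SimpleGraph.mem_edgeFinset, SimpleGraph.mem_edgeSet, mem_erase,
      mem_univ, and_true]
    refine ⟨fun h u hu huv => (h u huv).resolve_left hu.1, fun h u huv => ?_⟩
    by_cases huw : u = w
    · exact Or.inl huw
    · exact Or.inr (h u ⟨huw, huv.ne'⟩ huv)
  all_goals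
    simp only [mem_erase, mem_univ, and_true, SimpleGraph.mem_edgeFinset, SimpleGraph.mem_edgeSet,
      SimpleGraph.top_adj, Ne, Sym2.eq_iff]
    grind

theorem gnpWeight_nonneg (n : ℕ) {p : ℝ} (h0 : 0 ≤ p) (h1 : p ≤ 1) (Γ : SimpleGraph (Fin n)) :
    0 ≤ gnpWeight n p Γ :=
  mul_nonneg (pow_nonneg h0 _) (pow_nonneg (sub_nonneg.2 h1) _)

theorem gnpProb_le_one (n : ℕ) {p : ℝ} (h0 : 0 ≤ p) (h1 : p ≤ 1)
    (A : SimpleGraph (Fin n) → Prop) : gnpProb n p A ≤ 1 := by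
  rw [← gnpProb_true n p]
  refine sum_le_sum fun Γ _ => ?_
  have := gnpWeight_nonneg n h0 h1 Γ
  split_ifs <;> simp_all

/-- The first-moment bound. -/
theorem one_sub_le_gnpProb (n : ℕ) {p : ℝ} (h0 : 0 ≤ p) (h1 : p ≤ 1) :
    1 - (n : ℝ) ^ 2 * (1 - p * (1 - p)) ^ (n - 2) ≤
      gnpProb n p (fun Γ => ∀ v w : Fin n, v ≠ w → ¬ LinkSubsetStar Γ v w) := by
  have hx : 0 ≤ 1 - p * (1 - p) := by nlinarith
  have hsum : ∑ x : Fin n × Fin n, (if x.1 ≠ x.2 then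
      gnpProb n p (fun Γ => LinkSubsetStar Γ x.1 x.2) else 0) ≤
      (n : ℝ) ^ 2 * (1 - p * (1 - p)) ^ (n - 2) := by
    calc _ ≤ ∑ x : Fin n × Fin n, (1 - p * (1 - p)) ^ (n - 2) := by
          refine sum_le_sum fun x _ => ?_
          split_ifs with h
          · rw [gnpProb_linkSubsetStar n p h]
          · positivity
      _ = _ := by simp [sq]
  have hunion : gnpProb n p (fun _ => True) ≤
      gnpProb n p (fun Γ => ∀ v w : Fin n, v ≠ w → ¬ LinkSubsetStar Γ v w) +
      ∑ x : Fin n × Fin n, (if x.1 ≠ x.2 then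
        gnpProb n p (fun Γ => LinkSubsetStar Γ x.1 x.2) else 0) := by
    have hswap : ∑ x : Fin n × Fin n, (if x.1 ≠ x.2 then
        gnpProb n p (fun Γ => LinkSubsetStar Γ x.1 x.2) else 0) =
        ∑ Γ : SimpleGraph (Fin n), ∑ x : Fin n × Fin n,
          (if x.1 ≠ x.2 ∧ LinkSubsetStar Γ x.1 x.2 then gnpWeight n p Γ else 0) := by
      rw [sum_comm]
      refine sum_congr rfl fun x _ => ?_
      by_cases h : x.1 = x.2 <;> simp [h, gnpProb]
    rw [hswap]
    unfold gnpProb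
    rw [← sum_add_distrib]
    refine sum_le_sum fun Γ _ => ?_
    have hw := gnpWeight_nonneg n h0 h1 Γ
    have hterm : ∀ x ∈ (univ : Finset (Fin n × Fin n)),
        0 ≤ (if x.1 ≠ x.2 ∧ LinkSubsetStar Γ x.1 x.2 then gnpWeight n p Γ else 0) := by
      intro x _
      split_ifs <;> simp [hw]
    by_cases h : ∀ v w : Fin n, v ≠ w → ¬ LinkSubsetStar Γ v w
    · rw [if_pos trivial, if_pos h]
      exact le_add_of_nonneg_right (sum_nonneg hterm)
    · rw [if_pos trivial, if_neg h, zero_add]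
      push Not at h
      obtain ⟨v, w, hvw⟩ := h
      have := single_le_sum hterm (mem_univ (v, w))
      rwa [if_pos hvw] at this
  rw [gnpProb_true] at hunion
  linarith

theorem sq_mul_one_sub_pow_le {n : ℕ} (hn : 2 ≤ n) {x : ℝ} (h1 : x ≤ 1 / 2) :
    (n : ℝ) ^ 2 * (1 - x) ^ (n - 2) ≤ Real.exp 1 * Real.exp (-(n * x - 2 * Real.log n)) := by
  have hn0 : (0 : ℝ) < n := by positivity
  have hpow : (1 - x) ^ (n - 2) ≤ Real.exp (-((n : ℝ) - 2) * x) := by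
    calc (1 - x) ^ (n - 2) ≤ Real.exp (-x) ^ (n - 2) :=
          pow_le_pow_left₀ (by linarith) (Real.one_sub_le_exp_neg x) _
      _ = _ := by
          rw [← Real.exp_nat_mul, Nat.cast_sub hn]
          congr 1
          push_cast
          ring
  have hsq : (n : ℝ) ^ 2 = Real.exp (2 * Real.log n) := by
    rw [two_mul, Real.exp_add, Real.exp_log hn0, sq]
  calc _ ≤ (n : ℝ) ^ 2 * Real.exp (-((n : ℝ) - 2) * x) := by gcongr
    _ ≤ _ := by
        rw [hsq, ← Real.exp_add, ← Real.exp_add, Real.exp_le_exp]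
        linarith

theorem tendsto_gnpProb_no_lk_star_pair (p : ℕ → ℝ) (hp : ∀ n, 0 < p n ∧ p n < 1)
    (h : Tendsto (fun n : ℕ => (n : ℝ) * p n * (1 - p n) - 2 * Real.log n) atTop atTop) :
    Tendsto (fun n : ℕ =>
      gnpProb n (p n) (fun Γ => ∀ v w : Fin n, v ≠ w → ¬ LinkSubsetStar Γ v w))
      atTop (nhds 1) := by
  have hlim : Tendsto (fun n : ℕ => 1 - Real.exp 1 *
      Real.exp (-((n : ℝ) * p n * (1 - p n) - 2 * Real.log n))) atTop (nhds 1) := by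
    have := ((Real.tendsto_exp_neg_atTop_nhds_zero.comp h).const_mul (Real.exp 1)).const_sub 1
    simpa using this
  refine tendsto_of_tendsto_of_tendsto_of_le_of_le' hlim tendsto_const_nhds ?_
    (Eventually.of_forall fun n => gnpProb_le_one n (hp n).1.le (hp n).2.le _)
  filter_upwards [eventually_ge_atTop 2] with n hn
  refine le_trans ?_ (one_sub_le_gnpProb n (hp n).1.le (hp n).2.le)
  have hx : p n * (1 - p n) ≤ 1 / 2 := by nlinarith [sq_nonneg (p n - 1 / 2)]
  have := sq_mul_one_sub_pow_le hn hx
  rw [← mul_assoc] at this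
  linarith

theorem tendsto_nat_mul_sub_two_mul_log {c : ℝ} (hc : 0 < c) :
    Tendsto (fun n : ℕ => (n : ℝ) * c - 2 * Real.log n) atTop atTop := by
  have hlog := (Real.isLittleO_log_id_atTop.comp_tendsto
    tendsto_natCast_atTop_atTop).bound (show 0 < c / 4 by positivity)
  refine tendsto_atTop_mono' atTop ?_
    ((tendsto_natCast_atTop_atTop (R := ℝ)).atTop_mul_const (show 0 < c / 2 by positivity))
  filter_upwards [hlog] with n hn
  simp only [Function.comp_apply, id, Real.norm_eq_abs, Nat.abs_cast] at hn
  have := le_abs_self (Real.log n)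
  linarith

/-- If `n·p(n)·(1-p(n)) - 2·log n → ∞`, then a.a.s. `Γ ∈ G(n, p(n))` contains no ordered
pair of distinct vertices `(v,w)` with `lk(v) ⊆ st(w)`; in particular this holds for any
constant `p` with `0 < p < 1`. -/
theorem gnp_aas_no_lk_star_pair :
    (∀ p : ℕ → ℝ, (∀ n, 0 < p n ∧ p n < 1) →
      Tendsto (fun n : ℕ => (n : ℝ) * p n * (1 - p n) - 2 * Real.log n) atTop atTop →
      Tendsto (fun n : ℕ =>
        gnpProb n (p n) (fun Γ => ∀ v w : Fin n, v ≠ w → ¬ LinkSubsetStar Γ v w))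
        atTop (nhds 1)) ∧
    (∀ q : ℝ, 0 < q → q < 1 →
      Tendsto (fun n : ℕ =>
        gnpProb n q (fun Γ => ∀ v w : Fin n, v ≠ w → ¬ LinkSubsetStar Γ v w))
        atTop (nhds 1)) := by
  refine ⟨tendsto_gnpProb_no_lk_star_pair, fun q h0 h1 =>
    tendsto_gnpProb_no_lk_star_pair (fun _ => q) (fun _ => ⟨h0, h1⟩) ?_⟩
  simpa only [mul_assoc] using tendsto_nat_mul_sub_two_mul_log (mul_pos h0 (sub_pos.2 h1))
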